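/- Let g₀:ℝ^{2+1}→{symmetric invertible 3×3 real matrices} be smooth with det g₀<0 and write dVol_{g₀}=√(−det g₀)dx. Let φₙ^{(1)}, φₙ^{(2)}, φₙ^{(3)} (n∈ℕ) and φ₀^{(1)}, φ₀^{(2)}, φ₀^{(3)} be smooth real functions on ℝ^{2+1}, with the φ₀^{(i)} smooth, such that for every compact K⊂ℝ^{2+1}: (1) max_i sup_n (‖∂(φₙ^{(i)}−φ₀^{(i)})‖_{L³(K)} + ‖□_{g₀}(φₙ^{(i)}−φ₀^{(i)})‖_{L³(K)}) < ∞, and (2) max_i ‖φₙ^{(i)}−φ₀^{(i)}‖_{L³(K)} → 0. Then for every smooth vector field X=X^α∂_α and every ϑ∈C_c^∞(ℝ^{2+1}): ∫ ϑ·(Xφₙ^{(1)})·g₀⁻¹(dφₙ^{(2)},dφₙ^{(3)}) dVol_{g₀} − ∫ ϑ·(Xφₙ^{(1)})·g₀⁻¹(dφ₀^{(2)},dφₙ^{(3)}) dVol_{g₀} − ∫ ϑ·(Xφₙ^{(1)})·g₀⁻¹(dφₙ^{(2)},dφ₀^{(3)}) dVol_{g₀} converges, as n→∞, to −∫ ϑ·(Xφ₀^{(1)})·g₀⁻¹(dφ₀^{(2)},dφ₀^{(3)})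 dVol_{g₀}. -/

import Mathlib

open MeasureTheory Real Filter
open scoped ENNReal

noncomputable section

abbrev E3 : Type := Fin 3 → ℝ

/-- Partial derivative in coordinate direction `α`. -/
noncomputable def pd (α : Fin 3) (f : E3 → ℝ) (x : E3) : ℝ :=
  fderiv ℝ f x (Pi.single α 1)

/-- Wave operator of a matrix-valued Lorentzian metric:
`□_g φ = (−det g)^{−1/2} ∂_α ((g⁻¹)^{αβ}(−det g)^{1/2} ∂_β φ)`. -/
noncomputable def boxM (g : E3 → Matrix (Fin 3) (Fin 3) ℝ) (φ : E3 → ℝ) (x : E3) : ℝ :=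
  (Real.sqrt (-(g x).det))⁻¹ *
    ∑ α, pd α (fun y => ∑ β', (g y)⁻¹ α β' * Real.sqrt (-(g y).det) * pd β' φ y) x

/-- Null form `g⁻¹(dφ, dψ) = (g⁻¹)^{αβ} ∂_α φ ∂_β ψ`. -/
noncomputable def nullFormM (g : E3 → Matrix (Fin 3) (Fin 3) ℝ) (φ ψ : E3 → ℝ) (x : E3) : ℝ :=
  ∑ α, ∑ β', (g x)⁻¹ α β' * pd α φ x * pd β' ψ x

/-- Real-valued smooth functions on `ℝ³`. -/
abbrev Smooth (f : E3 → ℝ) : Prop := ContDiff ℝ (⊤ : ℕ∞) f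

lemma Smooth.differentiable {f : E3 → ℝ} (hf : Smooth f) : Differentiable ℝ f :=
  ContDiff.differentiable hf (by simp)

lemma Smooth.sum {ι : Type*} [Fintype ι] {f : ι → E3 → ℝ} (hf : ∀ i, Smooth (f i)) :
    Smooth (fun x => ∑ i, f i x) :=
  ContDiff.sum fun i _ => hf i

lemma smooth_pd {f : E3 → ℝ} (hf : Smooth f) (α : Fin 3) : Smooth (pd α f) :=
  (ContDiff.fderiv_right (m := ((⊤ : ℕ∞) : WithTop ℕ∞)) hf (by simp)).clm_apply contDiff_const

lemma pd_mul {f g : E3 → ℝ} (hf : Smooth f) (hg : Smooth g) (α : Fin 3) :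
    pd α (fun x => f x * g x) = fun x => pd α f x * g x + f x * pd α g x := by
  funext x
  simp only [pd]
  rw [fderiv_fun_mul (hf.differentiable x) (hg.differentiable x)]
  simp
  ring

lemma pd_sub {f g : E3 → ℝ} (hf : Smooth f) (hg : Smooth g) (α : Fin 3) :
    pd α (fun x => f x - g x) = fun x => pd α f x - pd α g x := by
  funext x
  simp only [pd]
  rw [fderiv_fun_sub (hf.differentiable x) (hg.differentiable x)]
  simp

lemma pd_sum {ι : Type*} [Fintype ι] {f : ι → E3 → ℝ} (hf : ∀ i, Smooth (f i)) (α : Fin 3) :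
    pd α (fun x => ∑ i, f i x) = fun x => ∑ i, pd α (f i) x := by
  funext x
  simp only [pd]
  rw [fderiv_fun_sum fun i _ => (hf i).differentiable x]
  simp

lemma pd_pd_eq_fderiv_fderiv {f : E3 → ℝ} (hf : Smooth f) (α β : Fin 3) (x : E3) :
    pd α (pd β f) x = fderiv ℝ (fderiv ℝ f) x (Pi.single α 1) (Pi.single β 1) := by
  have hd : Differentiable ℝ (fderiv ℝ f) :=
    (ContDiff.fderiv_right (m := ((⊤ : ℕ∞) : WithTop ℕ∞)) hf (by simp)).differentiable (by simp)
  have h : pd β f = fun y => fderiv ℝ f y (Pi.single β 1) := rfl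
  rw [pd, h, fderiv_clm_apply (hd x) (differentiableAt_const _)]
  simp

lemma pd_comm {f : E3 → ℝ} (hf : Smooth f) (α β : Fin 3) : pd α (pd β f) = pd β (pd α f) := by
  funext x
  rw [pd_pd_eq_fderiv_fderiv hf, pd_pd_eq_fderiv_fderiv hf]
  exact ContDiffAt.isSymmSndFDerivAt (ContDiff.contDiffAt hf)
    (by simpa using WithTop.coe_le_coe.2 (le_top (a := (2 : ℕ∞)))) _ _

lemma integral_mul_pd {f g : E3 → ℝ} (hf : Smooth f) (hc : HasCompactSupport f) (hg : Smooth g)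
    (α : Fin 3) : ∫ x, f x * pd α g x = -∫ x, pd α f x * g x := by
  have hc' : HasCompactSupport (pd α f) := hc.fderiv_apply ℝ _
  refine integral_mul_fderiv_eq_neg_fderiv_mul_of_integrable ?_ ?_ ?_
    (fun x _ => hf.differentiable x) (fun x _ => hg.differentiable x)
  · exact ((smooth_pd hf α).continuous.mul hg.continuous).integrable_of_hasCompactSupport
      hc'.mul_right
  · exact (hf.continuous.mul (smooth_pd hg α).continuous).integrable_of_hasCompactSupport
      hc.mul_right
  · exact (hf.continuous.mul hg.continuous).integrable_of_hasCompactSupport hc.mul_right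

lemma smooth_det {A : E3 → Matrix (Fin 3) (Fin 3) ℝ} (hA : ∀ α β, Smooth fun x => A x α β) :
    Smooth fun x => (A x).det := by
  simp only [Matrix.det_apply']
  exact Smooth.sum fun σ => contDiff_const.mul (contDiff_prod fun i _ => hA _ _)

lemma smooth_inv_apply {A : E3 → Matrix (Fin 3) (Fin 3) ℝ} (hA : ∀ α β, Smooth fun x => A x α β)
    (hdet : ∀ x, (A x).det ≠ 0) (α β : Fin 3) : Smooth fun x => (A x)⁻¹ α β := by
  simp only [Matrix.inv_def, Matrix.smul_apply, Matrix.adjugate_apply, Ring.inverse_eq_inv',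
    smul_eq_mul]
  refine ((smooth_det hA).inv hdet).mul (smooth_det fun i j => ?_)
  simp only [Matrix.updateRow_apply]
  split_ifs
  · exact contDiff_const
  · exact hA _ _

/-- Sequences of smooth functions that are eventually bounded in `L³` on every compact set. -/
def LocBdd (a : ℕ → E3 → ℝ) : Prop :=
  (∀ n, Smooth (a n)) ∧ ∀ K : Set E3, IsCompact K → ∃ C : ℝ, ∀ᶠ n in atTop,
    eLpNorm (a n) 3 (volume.restrict K) ≤ ENNReal.ofReal C

/-- Sequences of smooth functions that tend to zero in `L³` on every compact set. -/
def LocNull (a : ℕ → E3 → ℝ) : Prop :=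
  (∀ n, Smooth (a n)) ∧ ∀ K : Set E3, IsCompact K →
    Tendsto (fun n => eLpNorm (a n) 3 (volume.restrict K)) atTop (nhds 0)

/-- Sequences of smooth functions that tend to zero in the sense of distributions. -/
def WeakNull (F : ℕ → E3 → ℝ) : Prop :=
  (∀ n, Smooth (F n)) ∧ ∀ ϑ : E3 → ℝ, Smooth ϑ → HasCompactSupport ϑ →
    Tendsto (fun n => ∫ x, ϑ x * F n x) atTop (nhds 0)

lemma eLpNorm_mul_le_of_smooth {f : E3 → ℝ} (hf : Smooth f) {K : Set E3} (hK : IsCompact K) :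
    ∃ C : ℝ, ∀ a : E3 → ℝ, eLpNorm (fun x => f x * a x) 3 (volume.restrict K) ≤
      ENNReal.ofReal C * eLpNorm a 3 (volume.restrict K) := by
  obtain ⟨C, hC⟩ := hK.exists_bound_of_continuousOn hf.continuous.continuousOn
  refine ⟨C, fun a => eLpNorm_le_mul_eLpNorm_of_ae_le_mul ?_ 3⟩
  filter_upwards [ae_restrict_mem hK.measurableSet] with x hx
  rw [norm_mul]
  exact mul_le_mul_of_nonneg_right (hC x hx) (norm_nonneg _)

lemma LocNull.locBdd {a : ℕ → E3 → ℝ} (ha : LocNull a) : LocBdd a := by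
  refine ⟨ha.1, fun K hK => ⟨1, ?_⟩⟩
  filter_upwards [(ha.2 K hK).eventually (ge_mem_nhds zero_lt_one)] with n hn
  simpa using hn

lemma LocBdd.smul {a : ℕ → E3 → ℝ} (ha : LocBdd a) {f : E3 → ℝ} (hf : Smooth f) :
    LocBdd fun n x => f x * a n x := by
  refine ⟨fun n => hf.mul (ha.1 n), fun K hK => ?_⟩
  obtain ⟨C, hC⟩ := ha.2 K hK
  obtain ⟨D, hD⟩ := eLpNorm_mul_le_of_smooth hf hK
  refine ⟨max D 0 * C, ?_⟩
  filter_upwards [hC] with n hn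
  rw [ENNReal.ofReal_mul (le_max_right _ _)]
  refine (hD _).trans ?_
  gcongr
  exact le_max_left _ _

lemma LocBdd.sum {ι : Type*} [Fintype ι] {a : ι → ℕ → E3 → ℝ} (ha : ∀ i, LocBdd (a i)) :
    LocBdd fun n x => ∑ i, a i n x := by
  refine ⟨fun n => Smooth.sum fun i => (ha i).1 n, fun K hK => ?_⟩
  choose C hC using fun i => (ha i).2 K hK
  refine ⟨∑ i, max (C i) 0, ?_⟩
  filter_upwards [eventually_all.2 hC] with n hn
  have he : (fun x => ∑ i, a i n x) = ∑ i, a i n := by ext; simp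
  rw [he]
  refine (eLpNorm_sum_le (fun i _ => ((ha i).1 n).continuous.aestronglyMeasurable)
    (by norm_num)).trans ?_
  rw [ENNReal.ofReal_sum_of_nonneg fun i _ => le_max_right _ _]
  exact Finset.sum_le_sum fun i _ => (hn i).trans (ENNReal.ofReal_le_ofReal (le_max_left _ _))

lemma LocBdd.const {f : E3 → ℝ} (hf : Smooth f) : LocBdd fun _ => f := by
  refine ⟨fun _ => hf, fun K hK => ⟨(eLpNorm f 3 (volume.restrict K)).toReal, ?_⟩⟩
  refine Eventually.of_forall fun _ => ?_
  rw [ENNReal.ofReal_toReal]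
  have : IsFiniteMeasure (volume.restrict K) := ⟨by simpa using hK.measure_lt_top⟩
  obtain ⟨C, hC⟩ := hK.exists_bound_of_continuousOn hf.continuous.continuousOn
  refine (MemLp.of_bound hf.continuous.aestronglyMeasurable C ?_).eLpNorm_ne_top
  filter_upwards [ae_restrict_mem hK.measurableSet] with x hx using hC x hx

lemma eLpNorm_one_mul_mul_le {μ : Measure E3} {a b c : E3 → ℝ} (ha : Continuous a)
    (hb : Continuous b) (hc : Continuous c) :
    eLpNorm (fun x => a x * b x * c x) 1 μ ≤ eLpNorm a 3 μ * eLpNorm b 3 μ * eLpNorm c 3 μ := by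
  have h1 : ENNReal.HolderTriple 3 3 (3 / 2) := ⟨by
    rw [ENNReal.inv_div (by simp) (by simp), ← two_mul, ENNReal.div_eq_inv_mul, mul_comm]⟩
  have h2 : ENNReal.HolderTriple (3 / 2) 3 1 := ⟨by
    rw [ENNReal.inv_div (by simp) (by simp), inv_one, ← one_div, ENNReal.div_add_div_same]
    norm_num
    exact ENNReal.div_self (by simp) (by simp)⟩
  calc eLpNorm (fun x => a x * b x * c x) 1 μ
      ≤ eLpNorm (fun x => a x * b x) (3 / 2) μ * eLpNorm c 3 μ :=
        eLpNorm_smul_le_mul_eLpNorm (p := 3 / 2) (q := 3) (f := c) (φ := fun x => a x * b x)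
          hc.aestronglyMeasurable (ha.mul hb).aestronglyMeasurable
    _ ≤ _ := by
        gcongr
        exact eLpNorm_smul_le_mul_eLpNorm (p := 3) (q := 3) (f := b) (φ := a)
          hb.aestronglyMeasurable ha.aestronglyMeasurable

lemma WeakNull.of_mul {a b c : ℕ → E3 → ℝ} (ha : LocBdd a) (hb : LocBdd b) (hc : LocNull c) :
    WeakNull fun n x => a n x * b n x * c n x := by
  refine ⟨fun n => ((ha.1 n).mul (hb.1 n)).mul (hc.1 n), fun ϑ hϑ hs => ?_⟩
  obtain ⟨A, hA⟩ := (ha.smul hϑ).2 _ hs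
  obtain ⟨B, hB⟩ := hb.2 _ hs
  have hlim := ENNReal.Tendsto.const_mul (a := ENNReal.ofReal A * ENNReal.ofReal B)
    (hc.2 _ hs) (Or.inr (by finiteness))
  rw [mul_zero] at hlim
  rw [tendsto_zero_iff_enorm_tendsto_zero]
  refine tendsto_of_tendsto_of_tendsto_of_le_of_le' tendsto_const_nhds hlim
    (Eventually.of_forall fun _ => zero_le) ?_
  filter_upwards [hA, hB] with n hAn hBn
  rw [← setIntegral_eq_integral_of_forall_compl_eq_zero (s := tsupport ϑ)
    fun x hx => by rw [image_eq_zero_of_notMem_tsupport hx, zero_mul]]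
  refine (enorm_integral_le_lintegral_enorm _).trans ?_
  rw [← eLpNorm_one_eq_lintegral_enorm]
  have := eLpNorm_one_mul_mul_le (μ := volume.restrict (tsupport ϑ))
    (hϑ.mul (ha.1 n)).continuous (hb.1 n).continuous (hc.1 n).continuous
  simp only [← mul_assoc]
  exact this.trans (by gcongr)

lemma WeakNull.smul {F : ℕ → E3 → ℝ} (hF : WeakNull F) {f : E3 → ℝ} (hf : Smooth f) :
    WeakNull fun n x => f x * F n x := by
  refine ⟨fun n => hf.mul (hF.1 n), fun ϑ hϑ hs => ?_⟩
  simpa only [mul_assoc] using hF.2 (fun x => ϑ x * f x) (hϑ.mul hf) hs.mul_right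

lemma integrable_mul {f g : E3 → ℝ} (hf : Smooth f) (hs : HasCompactSupport f) (hg : Smooth g) :
    Integrable fun x => f x * g x :=
  (hf.continuous.mul hg.continuous).integrable_of_hasCompactSupport hs.mul_right

lemma WeakNull.sum {ι : Type*} [Fintype ι] {F : ι → ℕ → E3 → ℝ} (hF : ∀ i, WeakNull (F i)) :
    WeakNull fun n x => ∑ i, F i n x := by
  refine ⟨fun n => Smooth.sum fun i => (hF i).1 n, fun ϑ hϑ hs => ?_⟩
  simp only [Finset.mul_sum]
  have h : ∀ n, ∫ x, ∑ i, ϑ x * F i n x = ∑ i, ∫ x, ϑ x * F i n x := fun n =>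
    integral_finsetSum _ fun i _ => integrable_mul hϑ hs ((hF i).1 n)
  simp only [h]
  simpa using tendsto_finsetSum Finset.univ fun i _ => (hF i).2 ϑ hϑ hs

lemma WeakNull.sub {F G : ℕ → E3 → ℝ} (hF : WeakNull F) (hG : WeakNull G) :
    WeakNull fun n x => F n x - G n x := by
  refine ⟨fun n => (hF.1 n).sub (hG.1 n), fun ϑ hϑ hs => ?_⟩
  simp only [mul_sub]
  have h : ∀ n, ∫ x, (ϑ x * F n x - ϑ x * G n x) = (∫ x, ϑ x * F n x) - ∫ x, ϑ x * G n x :=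
    fun n => integral_sub (integrable_mul hϑ hs (hF.1 n)) (integrable_mul hϑ hs (hG.1 n))
  simp only [h]
  simpa using (hF.2 ϑ hϑ hs).sub (hG.2 ϑ hϑ hs)

lemma WeakNull.add {F G : ℕ → E3 → ℝ} (hF : WeakNull F) (hG : WeakNull G) :
    WeakNull fun n x => F n x + G n x := by
  simpa using hF.sub (hG.smul (f := fun _ => -1) contDiff_const)

lemma WeakNull.pd {F : ℕ → E3 → ℝ} (hF : WeakNull F) (α : Fin 3) :
    WeakNull fun n => pd α (F n) := by
  refine ⟨fun n => smooth_pd (hF.1 n) α, fun ϑ hϑ hs => ?_⟩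
  simp only [integral_mul_pd hϑ hs (hF.1 _)]
  simpa using (hF.2 (_root_.pd α ϑ) (smooth_pd hϑ α) (hs.fderiv_apply ℝ _)).neg

/-- The vector field `h^{αβ} ∂_β ψ`. -/
def flux (h : Fin 3 → Fin 3 → E3 → ℝ) (ψ : E3 → ℝ) (α : Fin 3) (x : E3) : ℝ :=
  ∑ β, h α β x * pd β ψ x

/-- The divergence-form operator `∂_α (h^{αβ} ∂_β ψ)`. -/
def divForm (h : Fin 3 → Fin 3 → E3 → ℝ) (ψ : E3 → ℝ) (x : E3) : ℝ :=
  ∑ α, pd α (flux h ψ α) x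

/-- The bilinear form `h^{αβ} ∂_α φ ∂_β ψ`. -/
def gradForm (h : Fin 3 → Fin 3 → E3 → ℝ) (φ ψ : E3 → ℝ) (x : E3) : ℝ :=
  ∑ α, ∑ β, h α β x * pd α φ x * pd β ψ x

section

variable {h : Fin 3 → Fin 3 → E3 → ℝ}

lemma smooth_flux (hh : ∀ α β, Smooth (h α β)) {ψ : E3 → ℝ} (hψ : Smooth ψ) (α : Fin 3) :
    Smooth (flux h ψ α) :=
  Smooth.sum fun β => (hh α β).mul (smooth_pd hψ β)

lemma smooth_divForm (hh : ∀ α β, Smooth (h α β)) {ψ : E3 → ℝ} (hψ : Smooth ψ) :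
    Smooth (divForm h ψ) :=
  Smooth.sum fun α => smooth_pd (smooth_flux hh hψ α) α

lemma smooth_gradForm (hh : ∀ α β, Smooth (h α β)) {φ ψ : E3 → ℝ} (hφ : Smooth φ)
    (hψ : Smooth ψ) : Smooth (gradForm h φ ψ) :=
  Smooth.sum fun α => Smooth.sum fun β => ((hh α β).mul (smooth_pd hφ α)).mul (smooth_pd hψ β)

lemma flux_mul {a b : E3 → ℝ} (ha : Smooth a) (hb : Smooth b) (α : Fin 3) :
    flux h (fun x => a x * b x) α = fun x => a x * flux h b α x + b x * flux h a α x := by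
  funext x
  simp only [flux, pd_mul ha hb, Fin.sum_univ_three]
  ring

lemma divForm_mul (hh : ∀ α β, Smooth (h α β)) (hs : ∀ α β, h α β = h β α) {a b : E3 → ℝ}
    (ha : Smooth a) (hb : Smooth b) (x : E3) :
    divForm h (fun x => a x * b x) x =
      a x * divForm h b x + b x * divForm h a x + 2 * gradForm h a b x := by
  have key : ∀ α, pd α (flux h (fun x => a x * b x) α) x =
      pd α a x * flux h b α x + a x * pd α (flux h b α) x +
        (pd α b x * flux h a α x + b x * pd α (flux h a α) x) := by
    intro α
    have hA := smooth_flux hh ha α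
    have hB := smooth_flux hh hb α
    rw [flux_mul ha hb, pd, fderiv_fun_add ((ha.mul hB).differentiable (by simp) x)
      ((hb.mul hA).differentiable (by simp) x), add_apply]
    exact congrArg₂ (· + ·) (congrFun (pd_mul ha hB α) x) (congrFun (pd_mul hb hA α) x)
  simp only [divForm, key]
  simp only [gradForm, flux, Fin.sum_univ_three, hs 1 0, hs 2 0, hs 2 1]
  ring

lemma pd_mul_divForm (hh : ∀ α β, Smooth (h α β)) (hs : ∀ α β, h α β = h β α) {ψ u : E3 → ℝ}
    (hψ : Smooth ψ) (hu : Smooth u) (γ : Fin 3) (x : E3) :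
    pd γ ψ x * divForm h u x =
      (∑ α, pd α (fun y => pd γ ψ y * flux h u α y) x)
        - (∑ β, pd β (fun y => pd γ (flux h ψ β) y * u y) x)
        + pd γ (divForm h ψ) x * u x
        + ∑ β, ∑ α, pd γ (h β α) x * (pd α ψ x * pd β u x) := by
  have e1 : ∀ α, pd α (fun y => pd γ ψ y * flux h u α y) x =
      pd γ (pd α ψ) x * flux h u α x + pd γ ψ x * pd α (flux h u α) x := fun α => by
    rw [pd_mul (smooth_pd hψ γ) (smooth_flux hh hu α), pd_comm hψ α γ]
  have e2 : ∀ β, pd β (fun y => pd γ (flux h ψ β) y * u y) x =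
      pd γ (pd β (flux h ψ β)) x * u x + pd γ (flux h ψ β) x * pd β u x := fun β => by
    rw [pd_mul (smooth_pd (smooth_flux hh hψ β) γ) hu, pd_comm (smooth_flux hh hψ β) β γ]
  have e3 : pd γ (divForm h ψ) x = ∑ β, pd γ (pd β (flux h ψ β)) x :=
    congrFun (pd_sum (fun β => smooth_pd (smooth_flux hh hψ β) β) γ) x
  have e4 : ∀ β, pd γ (flux h ψ β) x =
      ∑ α, (pd γ (h β α) x * pd α ψ x + h β α x * pd γ (pd α ψ) x) := fun β => by
    refine (congrFun (pd_sum (fun α => (hh β α).mul (smooth_pd hψ α)) γ) x).trans ?_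
    simp only [pd_mul (hh β _) (smooth_pd hψ _)]
  simp only [e1, e2, e3, e4]
  simp only [divForm, Fin.sum_univ_three]
  have e5 : ∀ α, flux h u α x = ∑ β, h α β x * pd β u x := fun _ => rfl
  simp only [e5, Fin.sum_univ_three, hs 1 0, hs 2 0, hs 2 1]
  ring

lemma WeakNull.pd_mul {a u : ℕ → E3 → ℝ} (ha : ∀ n, Smooth (a n)) (hu : ∀ n, Smooth (u n))
    {γ : Fin 3} (h0 : WeakNull fun n x => a n x * u n x)
    (h1 : WeakNull fun n x => a n x * _root_.pd γ (u n) x) :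
    WeakNull fun n x => _root_.pd γ (a n) x * u n x := by
  convert (h0.pd γ).sub h1 using 3 with n x
  rw [_root_.pd_mul (ha n) (hu n)]
  ring

lemma WeakNull.pd_mul_divForm (hh : ∀ α β, Smooth (h α β)) (hs : ∀ α β, h α β = h β α)
    {ψ u : ℕ → E3 → ℝ} (hψ : ∀ n, Smooth (ψ n)) (hu : ∀ n, Smooth (u n))
    (hdψ : ∀ α, LocBdd fun n => _root_.pd α (ψ n)) (hP : LocBdd fun n => divForm h (ψ n))
    (h0 : ∀ a, LocBdd a → WeakNull fun n x => a n x * u n x)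
    (h1 : ∀ a, LocBdd a → ∀ β, WeakNull fun n x => a n x * _root_.pd β (u n) x) (γ : Fin 3) :
    WeakNull fun n x => _root_.pd γ (ψ n) x * divForm h (u n) x := by
  have hV : ∀ β, LocBdd fun n => flux h (ψ n) β := fun β =>
    LocBdd.sum fun α => (hdψ α).smul (hh β α)
  have hW : ∀ α, WeakNull fun n x => _root_.pd γ (ψ n) x * flux h (u n) α x := fun α => by
    convert WeakNull.sum fun β => (h1 _ (hdψ γ) β).smul (hh α β) using 3 with n x
    rw [flux, Finset.mul_sum]
    exact Finset.sum_congr rfl fun β _ => by ring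
  convert (((WeakNull.sum fun α => (hW α).pd α).sub
    (WeakNull.sum fun β => (WeakNull.pd_mul (hV β).1 hu (h0 _ (hV β)) (h1 _ (hV β) γ)).pd β)).add
    (WeakNull.pd_mul hP.1 hu (h0 _ hP) (h1 _ hP γ))).add
    (WeakNull.sum fun β => WeakNull.sum fun α =>
      (h1 _ (hdψ α) β).smul (smooth_pd (hh β α) γ)) using 3 with n x
  exact _root_.pd_mul_divForm hh hs (hψ n) (hu n) γ x

/-- Div-curl lemma for the quadratic form `h`, tested against a locally bounded sequence `a`
for which `a · ∂_α(h^{αβ} ∂_β(bc))` tends weakly to zero. -/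
lemma WeakNull.mul_gradForm (hh : ∀ α β, Smooth (h α β)) (hs : ∀ α β, h α β = h β α)
    {a b c : ℕ → E3 → ℝ} (ha : LocBdd a) (hb : LocNull b) (hc : LocNull c)
    (hPb : LocBdd fun n => divForm h (b n)) (hPc : LocBdd fun n => divForm h (c n))
    (hu : WeakNull fun n x => a n x * divForm h (fun y => b n y * c n y) x) :
    WeakNull fun n x => a n x * gradForm h (b n) (c n) x := by
  convert ((hu.sub (WeakNull.of_mul ha hPc hb)).sub (WeakNull.of_mul ha hPb hc)).smul
    (f := fun _ => 1 / 2) contDiff_const using 3 with n x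
  rw [divForm_mul hh hs (hb.1 n) (hc.1 n)]
  ring

lemma WeakNull.divForm (hh : ∀ α β, Smooth (h α β)) {u : ℕ → E3 → ℝ} (hu : WeakNull u) :
    WeakNull fun n => divForm h (u n) :=
  WeakNull.sum fun α => WeakNull.pd (WeakNull.sum fun β => (hu.pd β).smul (hh α β)) α

/-- Compensated compactness: `h(dψ₁, dψ₂)` and `∂_γ ψ₀ · h(dψ₁, dψ₂)` tend weakly to zero. -/
lemma WeakNull.trilinear (hh : ∀ α β, Smooth (h α β)) (hs : ∀ α β, h α β = h β α)
    {ψ : Fin 3 → ℕ → E3 → ℝ} (hψ : ∀ i, LocNull (ψ i))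
    (hdψ : ∀ i α, LocBdd fun n => _root_.pd α (ψ i n))
    (hP : ∀ i, LocBdd fun n => _root_.divForm h (ψ i n)) :
    (WeakNull fun n x => gradForm h (ψ 1 n) (ψ 2 n) x) ∧
      ∀ γ, WeakNull fun n x => _root_.pd γ (ψ 0 n) x * gradForm h (ψ 1 n) (ψ 2 n) x := by
  have one : LocBdd fun _ _ => 1 := LocBdd.const contDiff_const
  have hu : ∀ n, Smooth fun x => ψ 1 n x * ψ 2 n x := fun n => ((hψ 1).1 n).mul ((hψ 2).1 n)
  have h0 : ∀ a, LocBdd a → WeakNull fun n x => a n x * (ψ 1 n x * ψ 2 n x) := fun a ha => by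
    simpa only [mul_assoc] using WeakNull.of_mul ha (hψ 1).locBdd (hψ 2)
  have h1 : ∀ a, LocBdd a → ∀ β, WeakNull fun n x =>
      a n x * _root_.pd β (fun x => ψ 1 n x * ψ 2 n x) x := fun a ha β => by
    convert (WeakNull.of_mul ha (hdψ 1 β) (hψ 2)).add (WeakNull.of_mul ha (hdψ 2 β) (hψ 1))
      using 3 with n x
    rw [_root_.pd_mul ((hψ 1).1 n) ((hψ 2).1 n)]
    ring
  constructor
  · have := WeakNull.divForm hh (h0 _ one)
    simp only [one_mul] at this
    simpa only [one_mul] using WeakNull.mul_gradForm hh hs one (hψ 1) (hψ 2) (hP 1) (hP 2)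
      (by simpa only [one_mul] using this)
  · exact fun γ => WeakNull.mul_gradForm hh hs (hdψ 0 γ) (hψ 1) (hψ 2) (hP 1) (hP 2)
      (WeakNull.pd_mul_divForm hh hs (hψ 0).1 hu (hdψ 0) (hP 0) h0 h1 γ)

end

/-- Proposition `prop:trilinear` of Huneau–Luk, trilinear compensated
compactness with non-trivial limits: with `L³_loc` bounds and convergence of
`φₙ^{(i)} − φ₀^{(i)}`, the trilinear combination
`(Xφₙ^{(1)})·g₀⁻¹(dφₙ^{(2)},dφₙ^{(3)}) − (Xφₙ^{(1)})·g₀⁻¹(dφ₀^{(2)},dφₙ^{(3)})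
 − (Xφₙ^{(1)})·g₀⁻¹(dφₙ^{(2)},dφ₀^{(3)})` converges, when tested against
`ϑ dVol_{g₀}`, to `−∫ ϑ·(Xφ₀^{(1)})·g₀⁻¹(dφ₀^{(2)},dφ₀^{(3)}) dVol_{g₀}`. -/
theorem stmt11
    (g₀ : E3 → Matrix (Fin 3) (Fin 3) ℝ)
    (hg₀ : ∀ α β', ContDiff ℝ (⊤ : ℕ∞) (fun x => g₀ x α β'))
    (hgsymm : ∀ x, (g₀ x).IsSymm)
    (hgdet : ∀ x, (g₀ x).det < 0)
    (φ : Fin 3 → ℕ → E3 → ℝ) (φlim : Fin 3 → E3 → ℝ)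
    (hφreg : ∀ i n, ContDiff ℝ (⊤ : ℕ∞) (φ i n))
    (hφlimreg : ∀ i, ContDiff ℝ (⊤ : ℕ∞) (φlim i))
    -- (1) uniform L³ bounds on gradients and wave operators of the differences
    (hbdd : ∀ K : Set E3, IsCompact K → ∃ C : ℝ, ∀ i n, ∀ α : Fin 3,
      eLpNorm (pd α (fun y => φ i n y - φlim i y)) 3 (volume.restrict K)
        ≤ ENNReal.ofReal C ∧
      eLpNorm (boxM g₀ (fun y => φ i n y - φlim i y)) 3 (volume.restrict K)
        ≤ ENNReal.ofReal C)
    -- (2) L³ convergence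
    (hconv : ∀ K : Set E3, IsCompact K → ∀ i,
      Tendsto (fun n => eLpNorm (fun y => φ i n y - φlim i y) 3 (volume.restrict K))
        atTop (nhds 0)) :
    ∀ X : Fin 3 → E3 → ℝ, (∀ α, ContDiff ℝ (⊤ : ℕ∞) (X α)) →
      ∀ ϑ : E3 → ℝ, ContDiff ℝ (⊤ : ℕ∞) ϑ → HasCompactSupport ϑ →
        Tendsto (fun n =>
          (∫ x, ϑ x * (∑ α, X α x * pd α (φ 0 n) x)
            * nullFormM g₀ (φ 1 n) (φ 2 n) x * Real.sqrt (-(g₀ x).det))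
          - (∫ x, ϑ x * (∑ α, X α x * pd α (φ 0 n) x)
            * nullFormM g₀ (φlim 1) (φ 2 n) x * Real.sqrt (-(g₀ x).det))
          - (∫ x, ϑ x * (∑ α, X α x * pd α (φ 0 n) x)
            * nullFormM g₀ (φ 1 n) (φlim 2) x * Real.sqrt (-(g₀ x).det)))
          atTop
          (nhds (-(∫ x, ϑ x * (∑ α, X α x * pd α (φlim 0) x)
            * nullFormM g₀ (φlim 1) (φlim 2) x * Real.sqrt (-(g₀ x).det)))) := by
  intro X hX ϑ hϑ hϑs
  have hw : Smooth fun x => Real.sqrt (-(g₀ x).det) :=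
    ContDiff.sqrt (smooth_det hg₀).neg fun x => (neg_pos.2 (hgdet x)).ne'
  have hw0 : ∀ x, Real.sqrt (-(g₀ x).det) ≠ 0 := fun x =>
    (Real.sqrt_pos.2 (neg_pos.2 (hgdet x))).ne'
  set h : Fin 3 → Fin 3 → E3 → ℝ := fun α β x => (g₀ x)⁻¹ α β * Real.sqrt (-(g₀ x).det) with h_def
  have hh : ∀ α β, Smooth (h α β) := fun α β =>
    (smooth_inv_apply hg₀ (fun x => (hgdet x).ne) α β).mul hw
  have hs : ∀ α β, h α β = h β α := fun α β => by
    funext x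
    have : ((g₀ x)⁻¹).transpose = (g₀ x)⁻¹ := by
      rw [Matrix.transpose_nonsing_inv, (hgsymm x).eq]
    simp only [h_def]
    rw [← this, Matrix.transpose_apply, this]
  have hform : ∀ a b x, nullFormM g₀ a b x * Real.sqrt (-(g₀ x).det) = gradForm h a b x := by
    intro a b x
    simp only [nullFormM, gradForm, h_def, Finset.sum_mul]
    exact Finset.sum_congr rfl fun α _ => Finset.sum_congr rfl fun β _ => by ring
  set ψ : Fin 3 → ℕ → E3 → ℝ := fun i n y => φ i n y - φlim i y with ψ_def
  have hψ : ∀ i, LocNull (ψ i) := fun i =>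
    ⟨fun n => (hφreg i n).sub (hφlimreg i), fun K hK => hconv K hK i⟩
  have hdψ : ∀ i α, LocBdd fun n => pd α (ψ i n) := fun i α =>
    ⟨fun n => smooth_pd ((hψ i).1 n) α, fun K hK =>
      (hbdd K hK).imp fun C hC => Eventually.of_forall fun n => (hC i n α).1⟩
  have hbox : ∀ i n, boxM g₀ (ψ i n) =
      fun x => (Real.sqrt (-(g₀ x).det))⁻¹ * divForm h (ψ i n) x := fun i n => rfl
  have hB : ∀ i, LocBdd fun n => boxM g₀ (ψ i n) := fun i =>
    ⟨fun n => (hw.inv hw0).mul (smooth_divForm hh ((hψ i).1 n)), fun K hK =>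
      (hbdd K hK).imp fun C hC => Eventually.of_forall fun n => (hC i n 0).2⟩
  have hP : ∀ i, LocBdd fun n => divForm h (ψ i n) := fun i => by
    convert (hB i).smul hw using 3 with n x
    rw [hbox, mul_inv_cancel_left₀ (hw0 x)]
  obtain ⟨hnull, htri⟩ := WeakNull.trilinear hh hs hψ hdψ hP
  have hψ0 : WeakNull (ψ 0) := by
    have one : LocBdd fun _ _ => 1 := LocBdd.const contDiff_const
    simpa only [one_mul] using WeakNull.of_mul one one (hψ 0)
  have hXsmooth : ∀ f, Smooth f → Smooth fun x => ∑ α, X α x * pd α f x := fun f hf =>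
    Smooth.sum fun α => (hX α).mul (smooth_pd hf α)
  have hlim : Smooth (gradForm h (φlim 1) (φlim 2)) :=
    smooth_gradForm hh (hφlimreg 1) (hφlimreg 2)
  have hW := ((WeakNull.sum fun γ => (htri γ).smul (hX γ)).add
    (hnull.smul (hXsmooth _ (hφlimreg 0)))).sub
    (WeakNull.sum fun γ => (hψ0.pd γ).smul ((hX γ).mul hlim))
  have hsplit : ∀ n x, (∑ γ, X γ x * (pd γ (ψ 0 n) x * gradForm h (ψ 1 n) (ψ 2 n) x))
        + (∑ α, X α x * pd α (φlim 0) x) * gradForm h (ψ 1 n) (ψ 2 n) x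
        - ∑ γ, X γ x * gradForm h (φlim 1) (φlim 2) x * pd γ (ψ 0 n) x =
      (∑ α, X α x * pd α (φ 0 n) x) * gradForm h (φ 1 n) (φ 2 n) x
        - (∑ α, X α x * pd α (φ 0 n) x) * gradForm h (φlim 1) (φ 2 n) x
        - (∑ α, X α x * pd α (φ 0 n) x) * gradForm h (φ 1 n) (φlim 2) x
        + (∑ α, X α x * pd α (φlim 0) x) * gradForm h (φlim 1) (φlim 2) x := by
    intro n x
    have hgrad : gradForm h (ψ 1 n) (ψ 2 n) x =
        gradForm h (φ 1 n) (φ 2 n) x - gradForm h (φlim 1) (φ 2 n) x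
          - gradForm h (φ 1 n) (φlim 2) x + gradForm h (φlim 1) (φlim 2) x := by
      simp only [gradForm, ψ_def, pd_sub (hφreg _ n) (hφlimreg _), Fin.sum_univ_three]
      ring
    rw [hgrad]
    simp only [ψ_def, pd_sub (hφreg _ n) (hφlimreg _), Fin.sum_univ_three]
    ring
  have hT := hW.2 ϑ hϑ hϑs
  simp only [hsplit] at hT
  simp only [mul_assoc, hform]
  have hint : ∀ f a b, Smooth f → Smooth a → Smooth b → Integrable fun x =>
      ϑ x * ((∑ α, X α x * pd α f x) * gradForm h a b x) := fun f a b hf ha hb =>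
    integrable_mul hϑ hϑs ((hXsmooth f hf).mul (smooth_gradForm hh ha hb))
  rw [← tendsto_sub_nhds_zero_iff]
  refine hT.congr fun n => ?_
  have i1 := hint _ _ _ (hφreg 0 n) (hφreg 1 n) (hφreg 2 n)
  have i2 := hint _ _ _ (hφreg 0 n) (hφlimreg 1) (hφreg 2 n)
  have i3 := hint _ _ _ (hφreg 0 n) (hφreg 1 n) (hφlimreg 2)
  have i4 := hint _ _ _ (hφlimreg 0) (hφlimreg 1) (hφlimreg 2)
  simp only [mul_add, mul_sub]
  rw [sub_neg_eq_add]
  exact (integral_add ((i1.sub i2).sub i3) i4).trans <| congrArg (· + _) <|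
    (integral_sub (i1.sub i2) i3).trans <| congrArg (· - _) (integral_sub i1 i2)

end
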